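/- For integers n ≥ 2, 2 ≤ j ≤ 2n+1, and 2 ≤ m ≤ 2n+1, and every positive integer k, Φ₁(k, φ_{c_{j,m,n}}) ≡ 0 (mod k), where φ_{c_{j,m,n}}(k) = c_{j,m,n,k}. -/

import Mathlib

open scoped Classical

/-- `Phi1 m φ = ∑_{d ∣ m, d squarefree} μ(d) · φ(m/d)`. -/
noncomputable def Phi1 (m : ℕ) (φ : ℕ → ℤ) : ℤ :=
  ∑ d ∈ m.divisors.filter (fun d => Squarefree d),
    (ArithmeticFunction.moebius d) * φ (m / d)

open PowerSeries in
/-- The power series `G` such that `X * g' = G * g` for some integral power series `g` with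
constant coefficient `1`. -/
noncomputable def eulerLogDeriv : AddSubgroup (PowerSeries ℤ) where
  carrier := {G | ∃ g : PowerSeries ℤ, constantCoeff g = 1 ∧ X * derivative ℤ g = G * g}
  zero_mem' := ⟨1, by simp, by simp⟩
  add_mem' := by
    rintro G H ⟨g, hg, hG⟩ ⟨h, hh, hH⟩
    refine ⟨g * h, by simp [hg, hh], ?_⟩
    rw [Derivation.leibniz, smul_eq_mul, smul_eq_mul]
    linear_combination h * hG + g * hH
  neg_mem' := by
    rintro G ⟨g, hg, hG⟩
    have hmul : g * invOfUnit g 1 = 1 := mul_invOfUnit g 1 (by simpa using hg)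
    refine ⟨invOfUnit g 1, by simp, ?_⟩
    have hder := congrArg (derivative ℤ) hmul
    rw [Derivation.leibniz, smul_eq_mul, smul_eq_mul, Derivation.map_one_eq_zero] at hder
    linear_combination (X * invOfUnit g 1) * hder - (invOfUnit g 1) ^ 2 * hG +
      (-X * derivative ℤ (invOfUnit g 1) - G * invOfUnit g 1) * hmul

open PowerSeries in
theorem dvd_coeff_of_mem_eulerLogDeriv {G : PowerSeries ℤ} (hG : G ∈ eulerLogDeriv) {N : ℕ}
    (hlow : ∀ n < N, coeff n G = 0) : (N : ℤ) ∣ coeff N G := by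
  obtain ⟨g, hg, h⟩ := hG
  obtain ⟨H, rfl⟩ := X_pow_dvd_iff.2 hlow
  have hN := congrArg (coeff N) h
  rw [mul_assoc, coeff_X_pow_mul', if_pos le_rfl, Nat.sub_self,
    coeff_zero_eq_constantCoeff_apply, map_mul constantCoeff, hg, mul_one] at hN
  rw [coeff_X_pow_mul', if_pos le_rfl, Nat.sub_self, coeff_zero_eq_constantCoeff_apply, ← hN]
  cases N with
  | zero => simp
  | succ N => exact ⟨coeff (N + 1) g, by simp [coeff_succ_X_mul, coeff_derivative, mul_comm]⟩

/-- The power series `k * X ^ k / (1 - X ^ k)`. -/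
noncomputable def lambertTerm (k : ℕ) : PowerSeries ℤ :=
  PowerSeries.mk fun n => if n ≠ 0 ∧ k ∣ n then (k : ℤ) else 0

open PowerSeries in
theorem lambertTerm_mul {k : ℕ} (hk : 0 < k) :
    lambertTerm k * (1 - X ^ k) = (k : PowerSeries ℤ) * X ^ k := by
  ext n
  rw [mul_sub, mul_one, map_sub, coeff_mul_X_pow', coeff_mul_X_pow', ← map_natCast (C (R := ℤ)),
    coeff_C]
  simp only [lambertTerm, coeff_mk]
  rcases lt_trichotomy n k with h | rfl | h
  · have : ¬ (n ≠ 0 ∧ k ∣ n) := fun ⟨h0, hd⟩ => by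
      have := Nat.le_of_dvd (Nat.pos_of_ne_zero h0) hd
      omega
    rw [if_neg this, if_neg (by omega), if_neg (by omega), sub_zero]
  · simp [hk.ne']
  · have hd : k ∣ n - k ↔ k ∣ n := (Nat.dvd_sub_iff_left h.le dvd_rfl)
    simp [h.le, hd, Nat.sub_ne_zero_of_lt h, (hk.trans h).ne']

open PowerSeries in
theorem lambertTerm_mem_eulerLogDeriv {k : ℕ} (hk : 0 < k) : lambertTerm k ∈ eulerLogDeriv := by
  rw [← neg_mem_iff]
  refine ⟨1 - X ^ k, by simp [hk.ne'], ?_⟩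
  rw [neg_mul, lambertTerm_mul hk, map_sub, Derivation.map_one_eq_zero, Derivation.leibniz_pow,
    zero_sub, derivative_X, smul_eq_mul, mul_one, nsmul_eq_mul]
  obtain ⟨k, rfl⟩ := Nat.exists_eq_succ_of_ne_zero hk.ne'
  simp only [Nat.succ_eq_add_one, Nat.add_sub_cancel, pow_succ]
  ring

theorem sum_divisors_Phi1 (φ : ℕ → ℤ) {n : ℕ} (hn : 0 < n) :
    ∑ d ∈ n.divisors, Phi1 d φ = φ n := by
  refine (ArithmeticFunction.sum_eq_iff_sum_mul_moebius_eq (f := fun d => Phi1 d φ)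
    (g := φ)).2 (fun m _ => ?_) n hn
  simp only [Int.cast_id]
  rw [Nat.sum_divisorsAntidiagonal (f := fun x y => ArithmeticFunction.moebius x * φ y), Phi1]
  refine (Finset.sum_filter_of_ne fun d _ hd => ?_).symm
  exact ArithmeticFunction.moebius_ne_zero_iff_squarefree.1 (left_ne_zero_of_mul hd)

open PowerSeries in
/-- Integrality of the exponents in a product expansion `∏ (1 - X ^ k) ^ b k`. -/
theorem dvd_Phi1_of_mem_eulerLogDeriv {φ : ℕ → ℤ}
    (hφ : (mk fun n => if n = 0 then 0 else φ n) ∈ eulerLogDeriv) {N : ℕ} (hN : 0 < N) :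
    (N : ℤ) ∣ Phi1 N φ := by
  induction N using Nat.strong_induction_on with
  | _ N ih =>
  set G : PowerSeries ℤ := mk (fun n => if n = 0 then 0 else φ n) -
    ∑ k ∈ Finset.Ico 1 N, (Phi1 k φ / k) • lambertTerm k with hGdef
  have hmem : G ∈ eulerLogDeriv := sub_mem hφ <| sum_mem fun k hk =>
    zsmul_mem (lambertTerm_mem_eulerLogDeriv (Finset.mem_Ico.1 hk).1) _
  have hcoeff (n : ℕ) (hn : 0 < n) :
      coeff n G = φ n - ∑ k ∈ n.divisors with k < N, Phi1 k φ := by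
    have hset : (n.divisors.filter (· < N)) = (Finset.Ico 1 N).filter (· ∣ n) := by
      ext k
      simp only [Finset.mem_filter, Nat.mem_divisors, Finset.mem_Ico]
      refine ⟨fun h => ⟨⟨Nat.pos_of_dvd_of_pos h.1.1 hn, h.2⟩, h.1.1⟩,
        fun h => ⟨⟨h.2, hn.ne'⟩, h.1.2⟩⟩
    rw [hGdef, map_sub, coeff_mk, if_neg hn.ne', map_sum, hset, Finset.sum_filter]
    congr 1
    refine Finset.sum_congr rfl fun k hk => ?_
    obtain ⟨hk1, hkN⟩ := Finset.mem_Ico.1 hk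
    rw [map_zsmul, lambertTerm, coeff_mk, smul_eq_mul]
    by_cases hd : k ∣ n
    · rw [if_pos ⟨hn.ne', hd⟩, if_pos hd, Int.ediv_mul_cancel (ih k hkN hk1)]
    · rw [if_neg (fun h => hd h.2), if_neg hd, mul_zero]
  have hlow : ∀ n < N, coeff n G = 0 := by
    intro n hnN
    rcases n.eq_zero_or_pos with rfl | hn
    · simp [hGdef, lambertTerm]
    · rw [hcoeff n hn, Finset.filter_true_of_mem fun k hk => (Nat.divisor_le hk).trans_lt hnN,
        sum_divisors_Phi1 φ hn, sub_self]
  have htop : coeff N G = Phi1 N φ := by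
    have hset : N.divisors.filter (· < N) = N.properDivisors := by
      ext k
      simp only [Finset.mem_filter, Nat.mem_divisors, Nat.mem_properDivisors]
      exact ⟨fun h => ⟨h.1.1, h.2⟩, fun h => ⟨⟨h.1, hN.ne'⟩, h.2⟩⟩
    rw [hcoeff N hN, hset, ← sum_divisors_Phi1 φ hN, ← Nat.insert_self_properDivisors hN.ne',
      Finset.sum_insert Nat.self_notMem_properDivisors, add_sub_cancel_right]
  exact htop ▸ dvd_coeff_of_mem_eulerLogDeriv hmem hlow

open PowerSeries in
/-- Newton's identities for a monic cubic, in generating-function form. -/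
theorem mem_eulerLogDeriv_of_cubic_recurrence {c : ℕ → ℤ} {a b d : ℤ} (h1 : c 1 = a)
    (h2 : c 2 = a ^ 2 - 2 * b) (h3 : c 3 = a ^ 3 - 3 * a * b - 3 * d)
    (hrec : ∀ k, c (k + 4) = a * c (k + 3) - b * c (k + 2) - d * c (k + 1)) :
    (mk fun n => if n = 0 then 0 else c n) ∈ eulerLogDeriv := by
  rw [← neg_mem_iff]
  refine ⟨1 - C a * X + C b * X ^ 2 + C d * X ^ 3, by simp, ?_⟩
  set F : PowerSeries ℤ := mk fun n => if n = 0 then 0 else c n with hF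
  have hprod : -F * (1 - C a * X + C b * X ^ 2 + C d * X ^ 3) =
      -F + C a * (F * X ^ 1) - C b * (F * X ^ 2) - C d * (F * X ^ 3) := by ring
  have hder : X * derivative ℤ (1 - C a * X + C b * X ^ 2 + C d * X ^ 3 : PowerSeries ℤ) =
      -(X ^ 1 * C a) + X ^ 2 * C (2 * b) + X ^ 3 * C (3 * d) := by
    simp [Derivation.leibniz, Derivation.leibniz_pow]
    ring
  rw [hprod, hder]
  ext n
  simp only [map_add, map_sub, map_neg, coeff_C_mul, coeff_mul_X_pow', coeff_X_pow_mul', coeff_C, hF, coeff_mk]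
  match n with
  | 0 => simp
  | 1 => simp [h1]
  | 2 => simp [h1, h2]; ring
  | 3 => simp [h1, h2, h3]; ring
  | n + 4 => simp [hrec]; ring

/-- For `n ≥ 2`, `2 ≤ j ≤ 2n+1`, `2 ≤ m ≤ 2n+1` and the sequence `c_{j,m,n,k}`,
`Φ₁(k, c_{j,m,n}) ≡ 0 (mod k)`. -/
theorem statement12 (n : ℕ) (hn : 2 ≤ n) (j m : ℤ)
    (hj1 : 2 ≤ j) (hj2 : j ≤ 2 * (n : ℤ) + 1)
    (hm1 : 2 ≤ m) (hm2 : m ≤ 2 * (n : ℤ) + 1)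
    (c : ℕ → ℤ)
    (hc1 : c 1 = 2 * (n : ℤ) + 1)
    (hc2 : c 2 = (2 * (n : ℤ) + 1) ^ 2 - 2 * (2 * (n : ℤ) - (j - m)))
    (hc3 : c 3 = (2 * (n : ℤ) + 1) ^ 3 - 6 * (n : ℤ) * (2 * (n : ℤ) + 1 - (j - m)))
    (hcRec : ∀ k : ℕ, 4 ≤ k →
      c k = (2 * (n : ℤ) + 1) * c (k - 1) - (2 * (n : ℤ) - (j - m)) * c (k - 2)
              - (j - m) * c (k - 3))
    (k : ℕ) (hk : 0 < k) :
    (k : ℤ) ∣ Phi1 k c := by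
  refine dvd_Phi1_of_mem_eulerLogDeriv (mem_eulerLogDeriv_of_cubic_recurrence
    (a := 2 * (n : ℤ) + 1) (b := 2 * (n : ℤ) - (j - m)) (d := j - m) hc1 hc2 ?_ ?_) hk
  · rw [hc3]
    ring
  · exact fun k => hcRec (k + 4) (by omega)
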